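/- arXiv:2408.12591 — 9 statements merged into one kernel-verified Lean document; each statement's English description precedes it below -/
import Mathlib

section
/- Let a ground normal logic program over N atoms with R rules be given, let I be an interpretation with interpretation vector v and complementary interpretation vector w, let Q be its program matrix and D its head matrix, and let min₁(x) = min x 1 applied entrywise. Then I satisfies the Clark completion of the program if and only if v = min₁(D.mulVec (fun i => 1 - min₁ ((Q.mulVec (fun p => 1 - w p)) i))), i.e. for every atom j : Fin N, v j = min 1 (∑ i, D j i * (1 - min 1 (∑ p, Q i p * (1 - w p)))). (Equivalently, the Euclidean distance between v and this vector is 0.) -/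
open Matrix

/-- Interpretation vector: indicator of `I`. -/
noncomputable def interpVec {N : ℕ} (I : Finset (Fin N)) : Fin N → ℝ :=
  fun j => if j ∈ I then 1 else 0

/-- Complementary interpretation vector. -/
noncomputable def compVec {N : ℕ} (I : Finset (Fin N)) : Fin N ⊕ Fin N → ℝ :=
  Sum.elim (interpVec I) (fun j => 1 - interpVec I j)

/-- Program matrix of a ground normal logic program (also used for constraints). -/
noncomputable def progMat {N R : ℕ} (pos neg : Fin R → Finset (Fin N)) :
    Matrix (Fin R) (Fin N ⊕ Fin N) ℝ :=
  fun i => Sum.elim (fun j => if j ∈ pos i then 1 else 0)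
                    (fun j => if j ∈ neg i then 1 else 0)

/-- Head matrix of a ground normal logic program. -/
noncomputable def headMat {N R : ℕ} (h : Fin R → Fin N) : Matrix (Fin N) (Fin R) ℝ :=
  fun j i => if h i = j then 1 else 0

/-- The body of rule `i` is satisfied by interpretation `I`. -/
def BodySat {N R : ℕ} (pos neg : Fin R → Finset (Fin N)) (I : Finset (Fin N))
    (i : Fin R) : Prop :=
  pos i ⊆ I ∧ neg i ∩ I = ∅

/-- `I` satisfies the Clark completion of the program. -/
def SatComp {N R : ℕ} (h : Fin R → Fin N) (pos neg : Fin R → Finset (Fin N))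
    (I : Finset (Fin N)) : Prop :=
  ∀ j : Fin N, j ∈ I ↔ ∃ i : Fin R, h i = j ∧ BodySat pos neg I i

/-- Truncating a finite count at `1` gives the indicator of existence. -/
lemma min_one_sum_indicator {ι : Type*} [Fintype ι] (P : ι → Prop)
    [DecidablePred P] [Decidable (∃ i, P i)] :
    min 1 (∑ i, if P i then (1 : ℝ) else 0) = if ∃ i, P i then 1 else 0 := by
  split_ifs with hP
  · obtain ⟨i, hi⟩ := hP
    refine min_eq_left ?_
    have key := Finset.single_le_sum (f := fun i => if P i then (1 : ℝ) else 0)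
      (fun i _ => by split_ifs <;> norm_num) (Finset.mem_univ i)
    simpa only [if_pos hi] using key
  · push Not at hP
    simp [hP]

open scoped Classical in
/-- The truncated count of violated body literals detects body satisfaction. -/
lemma one_sub_min_one_progMat_mulVec {N R : ℕ} (pos neg : Fin R → Finset (Fin N))
    (I : Finset (Fin N)) (i : Fin R) :
    1 - min 1 ((progMat pos neg).mulVec (fun p => 1 - compVec I p) i) =
      if BodySat pos neg I i then 1 else 0 := by
  have hsum : (progMat pos neg).mulVec (fun p => 1 - compVec I p) i =
      ∑ p, if Sum.elim (fun j => j ∈ pos i ∧ j ∉ I) (fun j => j ∈ neg i ∧ j ∈ I) p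
        then (1 : ℝ) else 0 := by
    rw [mulVec, dotProduct]
    refine Finset.sum_congr rfl fun p _ => ?_
    rcases p with j | j <;> by_cases hI : j ∈ I <;>
      simp [progMat, compVec, interpVec, hI]
  have hbody : (∃ p, Sum.elim (fun j => j ∈ pos i ∧ j ∉ I) (fun j => j ∈ neg i ∧ j ∈ I) p) ↔
      ¬ BodySat pos neg I i := by
    simp only [Sum.exists, Sum.elim_inl, Sum.elim_inr, BodySat, not_and_or,
      Finset.not_subset, ← Finset.nonempty_iff_ne_empty, ← ne_eq, Finset.Nonempty,
      Finset.mem_inter]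
  rw [hsum, min_one_sum_indicator]
  by_cases hB : BodySat pos neg I i <;> simp [hbody, hB]

theorem stmt_0 {N R : ℕ} (h : Fin R → Fin N) (pos neg : Fin R → Finset (Fin N))
    (I : Finset (Fin N)) :
    SatComp h pos neg I ↔
      ∀ j : Fin N,
        interpVec I j =
          min 1 ((headMat h).mulVec
            (fun i => 1 - min 1 ((progMat pos neg).mulVec
              (fun p => 1 - compVec I p) i)) j) := by
  classical
  refine forall_congr' fun j => ?_
  have hsum : (headMat h).mulVec (fun i => 1 - min 1 ((progMat pos neg).mulVec
      (fun p => 1 - compVec I p) i)) j =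
      ∑ i, if h i = j ∧ BodySat pos neg I i then (1 : ℝ) else 0 := by
    rw [mulVec, dotProduct]
    refine Finset.sum_congr rfl fun i _ => ?_
    rw [one_sub_min_one_progMat_mulVec, headMat, ite_and, ite_mul, one_mul, zero_mul]
  rw [hsum, min_one_sum_indicator, interpVec]
  by_cases hI : j ∈ I <;>
    by_cases hE : ∃ i, h i = j ∧ BodySat pos neg I i <;> simp only [hI, hE] <;> norm_num
end

section
/- Let a ground normal logic program over N atoms with R rules be given, with program matrix Q, interpretation I, and complementary interpretation vector w. Then for every rule i : Fin R, the i-th entry of Q.mulVec (fun p => 1 - w p) equals the number of false body literals of rule i under I, namely (Q.mulVec (fun p => 1 - w p)) i = |(pos i) \ I| + |(neg i) ∩ I| (as a real number). -/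
open Matrix

theorem stmt_1 {N R : ℕ} (pos neg : Fin R → Finset (Fin N)) (I : Finset (Fin N))
    (i : Fin R) :
    (progMat pos neg).mulVec (fun p => 1 - compVec I p) i =
      ((pos i \ I).card : ℝ) + ((neg i ∩ I).card : ℝ) := by
  simp only [mulVec, dotProduct, Fintype.sum_sum_type, progMat, compVec, interpVec,
    Sum.elim_inl, Sum.elim_inr, sub_sub_cancel]
  congr 1
  · rw [← Finset.filter_notMem_eq_sdiff, Finset.card_filter, Nat.cast_sum]
    simp only [ite_mul, one_mul, zero_mul, Finset.sum_ite_mem, Finset.univ_inter]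
    refine Finset.sum_congr rfl fun j _ => ?_
    split_ifs <;> simp_all
  · simp [Finset.inter_comm]
end

section
/- Let a ground normal logic program over N atoms with R rules be given, with program matrix Q, interpretation I, and complementary interpretation vector w. Then for every rule i : Fin R, the i-th entry of Q.mulVec w equals the number of true body literals of rule i under I, namely (Q.mulVec w) i = |(pos i) ∩ I| + |(neg i) \ I| (as a real number). -/
open Matrix

theorem stmt_2 {N R : ℕ} (pos neg : Fin R → Finset (Fin N)) (I : Finset (Fin N))
    (i : Fin R) :
    (progMat pos neg).mulVec (compVec I) i =
      ((pos i ∩ I).card : ℝ) + ((neg i \ I).card : ℝ) := by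
  have hneg (j : Fin N) : (if j ∈ neg i then (1 : ℝ) else 0) * (1 - if j ∈ I then 1 else 0) =
      if j ∈ neg i \ I then 1 else 0 := by
    by_cases h₁ : j ∈ neg i <;> by_cases h₂ : j ∈ I <;> simp [h₁, h₂]
  have hpos (j : Fin N) : (if j ∈ pos i then (1 : ℝ) else 0) * (if j ∈ I then 1 else 0) =
      if j ∈ pos i ∩ I then 1 else 0 := by
    by_cases h₁ : j ∈ pos i <;> by_cases h₂ : j ∈ I <;> simp [h₁, h₂]
  simp only [Matrix.mulVec, dotProduct, progMat, compVec, interpVec, Fintype.sum_sum_type,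
    Sum.elim_inl, Sum.elim_inr, hpos, hneg, Finset.sum_boole, Finset.filter_univ_mem]
end

section
/- Let a ground normal logic program over N atoms with R rules be given, with program matrix Q, head matrix D, interpretation I, complementary interpretation vector w, and body-truth vector z defined by z i = 1 - min 1 ((Q.mulVec (fun p => 1 - w p)) i). Then for every atom j : Fin N, (D.mulVec z) j equals the number of rules i with h i = j whose body is satisfied by I (as a real number). -/
open Matrix

instance {N R : ℕ} {pos neg : Fin R → Finset (Fin N)} {I : Finset (Fin N)} {i : Fin R} :
    Decidable (BodySat pos neg I i) :=
  inferInstanceAs (Decidable (_ ∧ _))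

/-- Body-truth vector `z`. -/
noncomputable def bodyVec {N R : ℕ} (pos neg : Fin R → Finset (Fin N))
    (I : Finset (Fin N)) : Fin R → ℝ :=
  fun i => 1 - min 1 ((progMat pos neg).mulVec (fun p => 1 - compVec I p) i)

/-- Indicator row of a set of atoms. -/
noncomputable def indRow {N : ℕ} (L : Finset (Fin N)) : Fin N → ℝ :=
  fun j => if j ∈ L then 1 else 0

/-- Rule `i` is an external support of `L`. -/
def ExtSupport {N R : ℕ} (h : Fin R → Fin N) (pos : Fin R → Finset (Fin N))
    (L : Finset (Fin N)) (i : Fin R) : Prop :=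
  h i ∈ L ∧ pos i ∩ L = ∅

instance {N R : ℕ} {h : Fin R → Fin N} {pos : Fin R → Finset (Fin N)}
    {L : Finset (Fin N)} {i : Fin R} : Decidable (ExtSupport h pos L i) :=
  inferInstanceAs (Decidable (_ ∧ _))

/-- External support matrix of `L`. -/
noncomputable def esMat {N R : ℕ} (h : Fin R → Fin N) (pos : Fin R → Finset (Fin N))
    (L : Finset (Fin N)) : Matrix (Fin N) (Fin R) ℝ :=
  fun j i => if h i = j ∧ ExtSupport h pos L i then 1 else 0

/-- Multiplying the program matrix by the falsity vector counts the false body literals. -/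
theorem progMat_mulVec_one_sub_compVec {N R : ℕ} (pos neg : Fin R → Finset (Fin N))
    (I : Finset (Fin N)) (i : Fin R) :
    (progMat pos neg).mulVec (fun p => 1 - compVec I p) i =
      (((pos i \ I).card + (neg i ∩ I).card : ℕ) : ℝ) := by
  have hpos : ∀ a, (if a ∈ pos i then (1 : ℝ) else 0) * (1 - if a ∈ I then 1 else 0) =
      if a ∈ pos i \ I then 1 else 0 := by
    intro a
    by_cases h₁ : a ∈ pos i <;> by_cases h₂ : a ∈ I <;> simp [h₁, h₂]
  have hneg : ∀ a, (if a ∈ neg i then (1 : ℝ) else 0) * (1 - (1 - if a ∈ I then 1 else 0)) =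
      if a ∈ neg i ∩ I then 1 else 0 := by
    intro a
    by_cases h₁ : a ∈ neg i <;> by_cases h₂ : a ∈ I <;> simp [h₁, h₂]
  simp only [mulVec, dotProduct, progMat, compVec, interpVec, Fintype.sum_sum_type,
    Sum.elim_inl, Sum.elim_inr, hpos, hneg, Finset.sum_boole, Finset.filter_univ_mem]
  push_cast
  rfl

/-- The body-truth vector is the indicator of the rules whose body is satisfied. -/
theorem bodyVec_apply {N R : ℕ} (pos neg : Fin R → Finset (Fin N))
    (I : Finset (Fin N)) (i : Fin R) :
    bodyVec pos neg I i = if BodySat pos neg I i then 1 else 0 := by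
  have hsat : BodySat pos neg I i ↔ (pos i \ I).card + (neg i ∩ I).card = 0 := by
    simp only [BodySat, Nat.add_eq_zero_iff, Finset.card_eq_zero, Finset.sdiff_eq_empty_iff_subset]
  rw [bodyVec, progMat_mulVec_one_sub_compVec]
  split_ifs with hb
  · simp [hsat.mp hb]
  · have hle : (1 : ℝ) ≤ (((pos i \ I).card + (neg i ∩ I).card : ℕ) : ℝ) := by
      exact_mod_cast Nat.one_le_iff_ne_zero.mpr (mt hsat.mpr hb)
    rw [min_eq_left hle, sub_self]

theorem stmt_4 {N R : ℕ} (h : Fin R → Fin N) (pos neg : Fin R → Finset (Fin N))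
    (I : Finset (Fin N)) (j : Fin N) :
    (headMat h).mulVec (bodyVec pos neg I) j =
      ((Finset.univ.filter (fun i : Fin R => h i = j ∧ BodySat pos neg I i)).card : ℝ) := by
  simp only [mulVec, dotProduct, headMat, bodyVec_apply, ← ite_and, ite_mul, one_mul, zero_mul,
    Finset.sum_boole]
end

section
/- Let a ground normal logic program over N atoms with R rules be given, with program matrix Q, head matrix D, interpretation I, complementary interpretation vector w, and body-truth vector z defined by z i = 1 - min 1 ((Q.mulVec (fun p => 1 - w p)) i). Define the head vector hI : Fin N → ℝ by hI j = min 1 ((D.mulVec z) j). Then for every atom j : Fin N, hI j = 1 if there exists a rule i with h i = j whose body is satisfied by I, and hI j = 0 otherwise. -/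
open Matrix

theorem min_one_natCast (n : ℕ) : min (1 : ℝ) n = if n = 0 then 0 else 1 := by
  split_ifs with hn
  · simp [hn]
  · exact min_eq_left (by exact_mod_cast Nat.one_le_iff_ne_zero.mpr hn)

theorem headMat_mulVec_bodyVec {N R : ℕ} (h : Fin R → Fin N)
    (pos neg : Fin R → Finset (Fin N)) (I : Finset (Fin N)) (j : Fin N) :
    (headMat h).mulVec (bodyVec pos neg I) j =
      (({i | h i = j ∧ BodySat pos neg I i} : Finset (Fin R)).card : ℝ) := by
  simp only [Matrix.mulVec, dotProduct, headMat, bodyVec_apply, ← ite_and, mul_ite, mul_one,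
    mul_zero, ← Finset.sum_boole]
  refine Finset.sum_congr rfl fun i _ => ?_
  by_cases h₁ : h i = j <;> by_cases h₂ : BodySat pos neg I i <;> simp [h₁, h₂]

theorem stmt_5 {N R : ℕ} (h : Fin R → Fin N) (pos neg : Fin R → Finset (Fin N))
    (I : Finset (Fin N)) (j : Fin N) :
    min 1 ((headMat h).mulVec (bodyVec pos neg I) j) =
      if ∃ i : Fin R, h i = j ∧ BodySat pos neg I i then 1 else 0 := by
  rw [headMat_mulVec_bodyVec, min_one_natCast]
  by_cases hex : ∃ i : Fin R, h i = j ∧ BodySat pos neg I i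
  · obtain ⟨i, hi⟩ := hex
    rw [if_neg (Finset.card_ne_zero_of_mem ((Finset.mem_filter_univ i).mpr hi)), if_pos ⟨i, hi⟩]
  · rw [if_neg hex, if_pos]
    exact Finset.card_eq_zero.mpr
      (Finset.filter_eq_empty_iff.mpr fun i _ hi => hex ⟨i, hi⟩)
end

section
/- Let a set of k constraints over N atoms be given with constraint matrix C, let I be an interpretation with interpretation vector v and complementary interpretation vector w. Then no constraint is violated by I (i.e. for every i : Fin k it is not the case that pos i ⊆ I and (neg i) ∩ I = ∅) if and only if for every i : Fin k, min 1 ((C.mulVec (fun p => 1 - w p)) i) = 1. (Equivalently, the Euclidean distance between the all-ones vector and the vector i ↦ min 1 ((C.mulVec (fun p => 1 - w p)) i) is 0.) -/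
open Matrix

theorem stmt_6 {N k : ℕ} (pos neg : Fin k → Finset (Fin N)) (I : Finset (Fin N)) :
    (∀ i : Fin k, ¬ (pos i ⊆ I ∧ neg i ∩ I = ∅)) ↔
      ∀ i : Fin k,
        min 1 ((progMat pos neg).mulVec (fun p => 1 - compVec I p) i) = 1 := by
  refine forall_congr' fun i => ?_
  rw [progMat_mulVec_one_sub_compVec, min_eq_left_iff, Nat.one_le_cast, Nat.one_le_iff_ne_zero,
    Ne, Nat.add_eq_zero_iff, Finset.card_eq_zero, Finset.card_eq_zero,
    Finset.sdiff_eq_empty_iff_subset]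
end

section
/- Let a set of k constraints over N atoms be given with constraint matrix C, let I be an interpretation with complementary interpretation vector w. Then for every constraint i : Fin k, min 1 ((C.mulVec (fun p => 1 - w p)) i) = 0 if constraint i is violated by I (i.e. pos i ⊆ I and (neg i) ∩ I = ∅), and min 1 ((C.mulVec (fun p => 1 - w p)) i) = 1 otherwise. -/
open Matrix

theorem stmt_7 {N k : ℕ} (pos neg : Fin k → Finset (Fin N)) (I : Finset (Fin N))
    (i : Fin k) :
    min 1 ((progMat pos neg).mulVec (fun p => 1 - compVec I p) i) =
      if pos i ⊆ I ∧ neg i ∩ I = ∅ then 0 else 1 := by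
  rw [progMat_mulVec_one_sub_compVec]
  have hviol : (pos i ⊆ I ∧ neg i ∩ I = ∅) ↔ (pos i \ I).card + (neg i ∩ I).card = 0 := by
    rw [Nat.add_eq_zero_iff, Finset.card_eq_zero, Finset.card_eq_zero,
      Finset.sdiff_eq_empty_iff_subset]
  split_ifs with h
  · simp [hviol.mp h]
  · refine min_eq_left ?_
    exact_mod_cast Nat.one_le_iff_ne_zero.mpr (fun h0 => h (hviol.mpr h0))
end

section
/- Let a set of k constraints over N atoms be given with constraint matrix C, let I be an interpretation with complementary interpretation vector w, and define the constraint violation vector c' : Fin k → ℝ by c' i = 1 - min 1 ((C.mulVec (fun p => 1 - w p)) i). Then c' is exactly the indicator vector of the violated constraints: for every i : Fin k, c' i = 1 if pos i ⊆ I and (neg i) ∩ I = ∅, and c' i = 0 otherwise. In particular, c' = 0 if and only if no constraint is violated by I. -/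
open Matrix

/-- The truncated count is the indicator of a satisfied body. -/
theorem one_sub_min_one_mulVec {N R : ℕ} (pos neg : Fin R → Finset (Fin N))
    (I : Finset (Fin N)) (i : Fin R) :
    (1 - min 1 ((progMat pos neg).mulVec (fun p => 1 - compVec I p) i)) =
      if pos i ⊆ I ∧ neg i ∩ I = ∅ then 1 else 0 := by
  rw [progMat_mulVec_one_sub_compVec]
  split_ifs with h
  · simp [Finset.sdiff_eq_empty_iff_subset.mpr h.1, h.2]
  · have hcard : 1 ≤ (pos i \ I).card + (neg i ∩ I).card := by
      by_contra hlt
      refine h ⟨?_, ?_⟩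
      · rw [← Finset.sdiff_eq_empty_iff_subset, ← Finset.card_eq_zero]
        omega
      · rw [← Finset.card_eq_zero]
        omega
    rw [min_eq_left (by exact_mod_cast hcard), sub_self]

theorem stmt_8 {N k : ℕ} (pos neg : Fin k → Finset (Fin N)) (I : Finset (Fin N)) :
    (∀ i : Fin k,
      (1 - min 1 ((progMat pos neg).mulVec (fun p => 1 - compVec I p) i)) =
        if pos i ⊆ I ∧ neg i ∩ I = ∅ then 1 else 0) ∧
    ((fun i : Fin k =>
        1 - min 1 ((progMat pos neg).mulVec (fun p => 1 - compVec I p) i)) = 0 ↔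
      ∀ i : Fin k, ¬ (pos i ⊆ I ∧ neg i ∩ I = ∅)) := by
  refine ⟨one_sub_min_one_mulVec pos neg I, ?_⟩
  simp only [one_sub_min_one_mulVec, funext_iff, Pi.zero_apply, ite_eq_right_iff, one_ne_zero,
    imp_false]
end

section
/- Let a ground normal logic program over N atoms with R rules be given, let I be an interpretation with interpretation vector v, complementary interpretation vector w, and body-truth vector z defined by z i = 1 - min 1 ((Q.mulVec (fun p => 1 - w p)) i). Let L₁, …, L_O be a finite family of nonempty sets of atoms with indicator rows ℓ_o and external support matrices ES_o, and for each o set u_o = min 1 (ℓ_o ⬝ᵥ (fun j => 1 - v j) + ℓ_o ⬝ᵥ ((ES_o).mulVec z)). Then ∑ o, (1 - u_o) = 0 if and only if for every o the conjunctive loop formula of L_o holds in I (i.e. if L_o ⊆ I then some external support rule of L_o has its body satisfied by I). -/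
open Matrix

theorem one_sub_min_one_natCast_eq_zero_iff (n : ℕ) :
    1 - min 1 (n : ℝ) = 0 ↔ n ≠ 0 := by
  rw [sub_eq_zero, eq_comm, min_eq_left_iff, Nat.one_le_cast, Nat.one_le_iff_ne_zero]

theorem indRow_dotProduct_one_sub_interpVec {N : ℕ} (L I : Finset (Fin N)) :
    indRow L ⬝ᵥ (fun j => 1 - interpVec I j) = ((L \ I).card : ℝ) := by
  have key : ∀ j, indRow L j * (1 - interpVec I j) = if j ∈ L \ I then 1 else 0 := by
    intro j
    by_cases hj : j ∈ L <;> by_cases hI : j ∈ I <;> simp [indRow, interpVec, hj, hI]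
  simp only [dotProduct, key, Finset.sum_boole, Finset.filter_univ_mem]

theorem indRow_dotProduct_interpVec {N : ℕ} (L I : Finset (Fin N)) :
    indRow L ⬝ᵥ interpVec I = ((L ∩ I).card : ℝ) := by
  have key : ∀ j, indRow L j * interpVec I j = if j ∈ L ∩ I then 1 else 0 := by
    intro j
    by_cases hj : j ∈ L <;> by_cases hI : j ∈ I <;> simp [indRow, interpVec, hj, hI]
  simp only [dotProduct, key, Finset.sum_boole, Finset.filter_univ_mem]

/-- The number of external support rules of `L` whose body is satisfied by `I`. -/
theorem indRow_dotProduct_esMat_mulVec_bodyVec {N R : ℕ} (h : Fin R → Fin N)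
    (pos neg : Fin R → Finset (Fin N)) (I L : Finset (Fin N)) :
    indRow L ⬝ᵥ (esMat h pos L).mulVec (bodyVec pos neg I) =
      ((Finset.univ.filter fun i => ExtSupport h pos L i ∧ BodySat pos neg I i).card : ℝ) := by
  have key : ∀ i, (indRow L ᵥ* esMat h pos L) i = if ExtSupport h pos L i then 1 else 0 := by
    intro i
    rw [vecMul, dotProduct, Finset.sum_eq_single (h i)]
    · by_cases hs : ExtSupport h pos L i
      · simp [indRow, esMat, hs, hs.1]
      · simp [esMat, hs]
    · intro j _ hj
      simp [esMat, hj.symm]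
    · simp
  rw [dotProduct_mulVec, dotProduct, ← Finset.sum_boole]
  refine Finset.sum_congr rfl fun i _ => ?_
  rw [key, bodyVec_apply, ite_zero_mul_ite_zero, one_mul]

theorem stmt_12 {N R O : ℕ} (h : Fin R → Fin N) (pos neg : Fin R → Finset (Fin N))
    (I : Finset (Fin N)) (L : Fin O → Finset (Fin N)) (hL : ∀ o, (L o).Nonempty) :
    (∑ o : Fin O,
        (1 - min 1 (indRow (L o) ⬝ᵥ (fun j => 1 - interpVec I j) +
          indRow (L o) ⬝ᵥ (esMat h pos (L o)).mulVec (bodyVec pos neg I)))) = 0 ↔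
      ∀ o : Fin O, L o ⊆ I →
        ∃ i : Fin R, ExtSupport h pos (L o) i ∧ BodySat pos neg I i := by
  have nonneg : ∀ x : ℝ, 0 ≤ 1 - min 1 x := fun x => sub_nonneg.2 (min_le_left 1 x)
  rw [Finset.sum_eq_zero_iff_of_nonneg fun _ _ => nonneg _]
  simp only [Finset.mem_univ, true_imp_iff]
  refine forall_congr' fun o => ?_
  rw [indRow_dotProduct_one_sub_interpVec, indRow_dotProduct_esMat_mulVec_bodyVec,
    ← Nat.cast_add, one_sub_min_one_natCast_eq_zero_iff, Ne, Nat.add_eq_zero_iff, not_and,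
    Finset.card_eq_zero, Finset.sdiff_eq_empty_iff_subset, ← Ne, Finset.card_ne_zero,
    Finset.filter_nonempty_iff]
  simp only [Finset.mem_univ, true_and]
end
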